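/- arXiv:0909.5580 — 2 statements merged into one kernel-verified Lean document; each statement's English description precedes it below -/
import Mathlib

section
/- Let λ ∈ ℤ[H] be irreducible with λ ≐ λ̄. Then the map sending p ∈ Q(H)^× to (the exponent of λ in p) mod 2 is a surjective group homomorphism Q(H)^× → ℤ/2ℤ which vanishes on N(H); hence it descends to a surjective group homomorphism Ψ_λ : Q(H)^×/N(H) → ℤ/2ℤ. (The homomorphism Ψ_λ redefined as in Section 8, used for the Torelli subgroup results.) -/
noncomputable section
open scoped nonZeroDivisors

/-- The integral group ring `ℤ[H]` of the free abelian group `H = ℤ^m`. -/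
abbrev GR (m : ℕ) : Type := AddMonoidAlgebra ℤ (Fin m → ℤ)

instance (m : ℕ) : IsDomain (GR m) := NoZeroDivisors.to_isDomain _

/-- The quotient field `Q(H)` of `ℤ[H]`. -/
abbrev QF (m : ℕ) : Type := FractionRing (GR m)

/-- The inclusion `ℤ[H] → Q(H)`. -/
abbrev incl (m : ℕ) : GR m →+* QF m := algebraMap (GR m) (QF m)

/-- The involution `p ↦ p̄` of `ℤ[H]`, induced by `h ↦ h⁻¹`. -/
def barR (m : ℕ) : GR m ≃+* GR m :=
  (AddMonoidAlgebra.domCongr ℤ ℤ (AddEquiv.neg (Fin m → ℤ))).toRingEquiv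

/-- The involution `p ↦ p̄` of `Q(H)`. -/
def barQ (m : ℕ) : QF m ≃+* QF m :=
  IsFractionRing.ringEquivOfRingEquiv (barR m)

/-- `p ≐ q` in `ℤ[H]`: `p = ±h·q` for some `h ∈ H`. -/
def doteqR {m : ℕ} (p q : GR m) : Prop :=
  ∃ (u : ℤˣ) (h : Fin m → ℤ), p = AddMonoidAlgebra.single h (u : ℤ) * q

/-- The subgroup `N(H) = {±h·q·q̄}` of `Q(H)^×`. -/
def NH (m : ℕ) : Subgroup (QF m)ˣ :=
  Subgroup.closure {x : (QF m)ˣ |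
    ∃ (u : ℤˣ) (h : Fin m → ℤ) (q : (QF m)ˣ),
      (x : QF m) = incl m (AddMonoidAlgebra.single h (u : ℤ)) * ↑q * barQ m ↑q}

open UniqueFactorizationMonoid in
/-- The exponent of (the associate class of) an irreducible `μ` in `r ∈ ℤ[H]`. -/
def expR (m : ℕ) [UniqueFactorizationMonoid (GR m)] (μ r : GR m) : ℕ :=
  Multiset.card (@Multiset.filter _ (fun l => Associated l μ)
    (Classical.decPred _) (factors r))

/-- The exponent of an irreducible `μ` in `p ∈ Q(H)^×`, via a choice of fraction
representation. -/
def expQ (m : ℕ) [UniqueFactorizationMonoid (GR m)] (μ : GR m) (p : QF m) : ℤ :=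
  (expR m μ (IsLocalization.sec (GR m)⁰ p).1 : ℤ) -
    (expR m μ ((IsLocalization.sec (GR m)⁰ p).2 : GR m) : ℤ)

open UniqueFactorizationMonoid

theorem Multiset.Rel.card_filter_associated_eq {α : Type*} [Monoid α] {s t : Multiset α}
    (h : Multiset.Rel Associated s t) (a : α) [DecidablePred fun b => Associated b a] :
    Multiset.card (s.filter (Associated · a)) = Multiset.card (t.filter (Associated · a)) := by
  induction h with
  | zero => rfl
  | @cons b c s t hbc _ ih =>
    have hiff : Associated b a ↔ Associated c a := ⟨hbc.symm.trans, hbc.trans⟩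
    by_cases hc : Associated c a <;> simp [hiff, hc, ih]

theorem associated_barR_iff {m : ℕ} {a b : GR m} :
    Associated (barR m a) (barR m b) ↔ Associated a b := by
  refine ⟨fun h => ?_, fun h => h.map (barR m)⟩
  simpa using h.map (barR m).symm

section ExponentInGroupRing

variable {m : ℕ} [UniqueFactorizationMonoid (GR m)]

theorem expR_mul (l : GR m) {a b : GR m} (ha : a ≠ 0) (hb : b ≠ 0) :
    expR m l (a * b) = expR m l a + expR m l b := by
  classical
  unfold expR
  rw [(factors_mul ha hb).card_filter_associated_eq, Multiset.filter_add, Multiset.card_add]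

theorem expR_of_isUnit (l : GR m) {a : GR m} (ha : IsUnit a) : expR m l a = 0 := by
  have h := factors_rel_of_associated (associated_one_iff_isUnit.mpr ha)
  rw [factors_one, Multiset.rel_zero_right] at h
  rw [expR, h]
  rfl

theorem expR_self {l : GR m} (hl : Irreducible l) : expR m l l = 1 := by
  classical
  unfold expR
  have h : Multiset.Rel Associated (factors l) {l} :=
    factors_unique (fun x hx => irreducible_of_factor x hx) (by simpa using hl)
      (by simpa using factors_prod hl.ne_zero)
  rw [h.card_filter_associated_eq]
  simp [Multiset.filter_singleton]

theorem expR_barR {l : GR m} (hl : Associated l (barR m l)) {a : GR m} (ha : a ≠ 0) :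
    expR m l (barR m a) = expR m l a := by
  classical
  have h : Multiset.Rel Associated (factors (barR m a)) ((factors a).map (barR m)) := by
    refine factors_unique (fun x hx => irreducible_of_factor x hx) ?_ ?_
    · intro x hx
      obtain ⟨y, hy, rfl⟩ := Multiset.mem_map.mp hx
      exact (MulEquiv.irreducible_iff (barR m)).mpr (irreducible_of_factor y hy)
    · rw [← map_multiset_prod]
      exact (factors_prod (by simpa using ha)).trans ((factors_prod ha).symm.map (barR m))
  have hiff (x : GR m) : Associated (barR m x) l ↔ Associated x l :=
    ⟨fun hx => associated_barR_iff.mp (hx.trans hl),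
      fun hx => (associated_barR_iff.mpr hx).trans hl.symm⟩
  unfold expR
  rw [h.card_filter_associated_eq, Multiset.filter_map, Multiset.card_map]
  simp only [Function.comp_def, hiff]
  congr!

end ExponentInGroupRing

theorem isUnit_single_intUnit {m : ℕ} (u : ℤˣ) (h : Fin m → ℤ) :
    IsUnit (AddMonoidAlgebra.single h (u : ℤ) : GR m) := by
  refine IsUnit.of_mul_eq_one (AddMonoidAlgebra.single (-h) ((u⁻¹ : ℤˣ) : ℤ)) ?_
  simp [AddMonoidAlgebra.single_mul_single, AddMonoidAlgebra.one_def]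

theorem doteqR.associated {m : ℕ} {p q : GR m} (h : doteqR p q) : Associated p q := by
  obtain ⟨u, g, rfl⟩ := h
  exact associated_unit_mul_left q _ (isUnit_single_intUnit u g)

theorem exists_incl_div_incl {m : ℕ} (p : (QF m)ˣ) :
    ∃ a b : GR m, a ≠ 0 ∧ b ≠ 0 ∧ (p : QF m) = incl m a / incl m b := by
  obtain ⟨a, b, hb, h⟩ := IsFractionRing.div_surjective (A := GR m) (p : QF m)
  refine ⟨a, b, ?_, nonZeroDivisors.ne_zero hb, h.symm⟩
  rintro rfl
  exact p.ne_zero (by simp [← h])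

theorem barQ_incl {m : ℕ} (a : GR m) : barQ m (incl m a) = incl m (barR m a) :=
  IsFractionRing.ringEquivOfRingEquiv_algebraMap (barR m) a

section ExponentInFractionField

variable {m : ℕ} [UniqueFactorizationMonoid (GR m)]

theorem expQ_incl_div_incl (l : GR m) {a b : GR m} (ha : a ≠ 0) (hb : b ≠ 0) :
    expQ m l (incl m a / incl m b) = (expR m l a : ℤ) - expR m l b := by
  have hinj : Function.Injective (incl m) := IsFractionRing.injective (GR m) (QF m)
  have hb' : incl m b ≠ 0 := (map_ne_zero_iff _ hinj).mpr hb
  have hspec := IsLocalization.sec_spec (GR m)⁰ (incl m a / incl m b)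
  unfold expQ
  set s := IsLocalization.sec (GR m)⁰ (incl m a / incl m b)
  have hd : (s.2 : GR m) ≠ 0 := nonZeroDivisors.ne_zero s.2.2
  have hcross : a * s.2 = s.1 * b := by
    apply hinj
    rw [map_mul, map_mul, ← hspec]
    field_simp
  have hc : s.1 ≠ 0 := by
    intro h0
    rw [h0, zero_mul] at hcross
    exact mul_ne_zero ha hd hcross
  have h := congrArg (expR m l) hcross
  rw [expR_mul l ha hd, expR_mul l hc hb] at h
  lia

theorem expQ_mul (l : GR m) (p q : (QF m)ˣ) :
    expQ m l ((p * q : (QF m)ˣ) : QF m) = expQ m l (p : QF m) + expQ m l (q : QF m) := by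
  obtain ⟨a, b, ha, hb, hp⟩ := exists_incl_div_incl p
  obtain ⟨c, d, hc, hd, hq⟩ := exists_incl_div_incl q
  rw [Units.val_mul, hp, hq, div_mul_div_comm, ← map_mul, ← map_mul,
    expQ_incl_div_incl l (mul_ne_zero ha hc) (mul_ne_zero hb hd), expQ_incl_div_incl l ha hb,
    expQ_incl_div_incl l hc hd, expR_mul l ha hc, expR_mul l hb hd]
  lia

theorem expQ_norm {l : GR m} (hl : Associated l (barR m l)) {s : GR m} (hs : IsUnit s)
    (q : (QF m)ˣ) :
    expQ m l (incl m s * q * barQ m q) = 2 * expQ m l (q : QF m) := by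
  obtain ⟨a, b, ha, hb, hq⟩ := exists_incl_div_incl q
  have ha' : barR m a ≠ 0 := by simpa using ha
  have hb' : barR m b ≠ 0 := by simpa using hb
  have hsa : s * a ≠ 0 := mul_ne_zero hs.ne_zero ha
  rw [hq, map_div₀, barQ_incl, barQ_incl, ← mul_div_assoc (incl m s), div_mul_div_comm, ← map_mul,
    ← map_mul, ← map_mul, expQ_incl_div_incl l (mul_ne_zero hsa ha') (mul_ne_zero hb hb'),
    expQ_incl_div_incl l ha hb, expR_mul l hsa ha', expR_mul l hs.ne_zero ha,
    expR_mul l hb hb', expR_barR hl ha, expR_barR hl hb, expR_of_isUnit l hs]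
  lia

/-- The parity of the exponent of `l`, as a homomorphism on `Q(H)^×`. -/
def expQParity (l : GR m) : (QF m)ˣ →* Multiplicative (ZMod 2) :=
  MonoidHom.mk' (fun p => Multiplicative.ofAdd (expQ m l (p : QF m) : ZMod 2)) fun p q => by
    rw [expQ_mul, Int.cast_add, ofAdd_add]

theorem expQParity_surjective {l : GR m} (hl : Irreducible l) :
    Function.Surjective (expQParity l) := by
  have hinj : Function.Injective (incl m) := IsFractionRing.injective (GR m) (QF m)
  have hl' : incl m l ≠ 0 := (map_ne_zero_iff _ hinj).mpr hl.ne_zero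
  have h1 : expQParity l (Units.mk0 (incl m l) hl') = Multiplicative.ofAdd 1 := by
    have h := expQ_incl_div_incl l hl.ne_zero (one_ne_zero (α := GR m))
    rw [map_one, div_one, expR_self hl, expR_of_isUnit l isUnit_one] at h
    simp [expQParity, h]
  intro z
  refine ⟨Units.mk0 (incl m l) hl' ^ (z.toAdd).val, ?_⟩
  rw [map_pow, h1, ← ofAdd_nsmul]
  simp

theorem NH_le_ker_expQParity {l : GR m} (hl : Associated l (barR m l)) :
    NH m ≤ (expQParity l).ker := by
  refine (Subgroup.closure_le _).mpr ?_
  rintro x ⟨u, h, q, hx⟩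
  refine MonoidHom.mem_ker.mpr (congrArg Multiplicative.ofAdd ?_)
  rw [hx, expQ_norm hl (isUnit_single_intUnit u h), Int.cast_mul]
  exact mul_eq_zero_of_left (by decide) _

end ExponentInFractionField

/-- **The homomorphism `Ψ_λ` redefined as in Section 8.**
For irreducible `λ` with `λ ≐ λ̄`, the map `p ↦ e_λ(p) mod 2` is a surjective
group homomorphism `Q(H)^× → ℤ/2` vanishing on `N(H)`; hence it descends to a
surjective homomorphism `Ψ_λ : Q(H)^×/N(H) → ℤ/2`. -/
theorem psi_lambda_descends_to_quotient_by_norms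
    (m : ℕ) [UniqueFactorizationMonoid (GR m)]
    (l : GR m) (hirr : Irreducible l) (hsd : doteqR l (barR m l)) :
    (∀ p q : (QF m)ˣ,
      ((expQ m l ((p * q : (QF m)ˣ) : QF m) : ZMod 2)) =
        (expQ m l (p : QF m) : ZMod 2) + (expQ m l (q : QF m) : ZMod 2)) ∧
    Function.Surjective (fun p : (QF m)ˣ => (expQ m l (p : QF m) : ZMod 2)) ∧
    (∀ p : (QF m)ˣ, p ∈ NH m → (expQ m l (p : QF m) : ZMod 2) = 0) ∧
    ∃ Ψ : (QF m)ˣ ⧸ NH m →* Multiplicative (ZMod 2),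
      Function.Surjective Ψ ∧
      ∀ p : (QF m)ˣ,
        Ψ (QuotientGroup.mk p) =
          Multiplicative.ofAdd ((expQ m l (p : QF m) : ZMod 2)) := by
  have hker := NH_le_ker_expQParity hsd.associated
  have hsurj := expQParity_surjective hirr
  refine ⟨fun p q => by rw [expQ_mul, Int.cast_add], hsurj,
    fun p hp => congrArg Multiplicative.toAdd (MonoidHom.mem_ker.mp (hker hp)),
    QuotientGroup.lift (NH m) (expQParity l) hker, fun z => ?_, fun p => rfl⟩
  obtain ⟨p, hp⟩ := hsurj z
  exact ⟨QuotientGroup.mk p, hp⟩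
end
end

section
/- Let H be a finitely generated free abelian group of rank at least 2. Then the quotient group Q(H)^×/N(H) is isomorphic to (⊕_{i∈ℕ} ℤ/2ℤ) ⊕ (⊕_{i∈ℕ} ℤ). (The case of Theorem 8.2 for surfaces Σ_{g,n} with n ≥ 2 and (g,n) ≠ (0,2), where H = H₁(Σ_{g,n}) has rank n−1+2g ≥ 2.) -/
noncomputable section
open scoped nonZeroDivisors

section Involution

variable {P : Type*} {σ : P → P}

/-- The coinvariants of an involution permuting the basis of a free abelian group of countable rank
are a direct sum of copies of `ℤ/2`, one for each fixed point, and of `ℤ`, one for each orbit of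
size two. -/
theorem exists_hom_ker_eq_range_add_mapDomain [Countable P] (hσ : Function.Involutive σ)
    (hfix : {p | σ p = p}.Infinite) (hmove : {p | σ p ≠ p}.Infinite) :
    ∃ θ : (P →₀ ℤ) →+ (ℕ →₀ ZMod 2) × (ℕ →₀ ℤ), Function.Surjective θ ∧
      ∀ x, θ x = 0 ↔ ∃ k : P →₀ ℤ, x = k + Finsupp.mapDomain σ k := by
  classical
  obtain ⟨enc, henc⟩ := exists_injective_nat P
  let F := {p : P // σ p = p}
  let T := {p : P // enc p < enc (σ p)}
  have : Infinite F := hfix.to_subtype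
  have : Infinite T := by
    by_contra h
    rw [not_infinite_iff_finite] at h
    have hT : {p : P | enc p < enc (σ p)}.Finite := Set.finite_coe_iff.1 h
    refine hmove ((hT.union (hT.image σ)).subset fun p hp => ?_)
    rcases lt_trichotomy (enc p) (enc (σ p)) with h | h | h
    · exact Or.inl h
    · exact absurd (henc h).symm hp
    · exact Or.inr ⟨σ p, by simpa [hσ p] using h, hσ p⟩
  obtain ⟨eF⟩ : Nonempty (F ≃ ℕ) := nonempty_equiv_of_countable
  obtain ⟨eT⟩ : Nonempty (T ≃ ℕ) := nonempty_equiv_of_countable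
  let S : AddSubgroup (P →₀ ℤ) :=
    (AddMonoidHom.id _ + Finsupp.mapDomain.addMonoidHom σ).range
  have hS : ∀ x, x ∈ S ↔ ∃ k : P →₀ ℤ, x = k + Finsupp.mapDomain σ k := fun x =>
    exists_congr fun k => eq_comm
  let g : P → (ℕ →₀ ZMod 2) × (ℕ →₀ ℤ) := fun p =>
    if h : σ p = p then (Finsupp.single (eF ⟨p, h⟩) 1, 0)
    else if h : enc p < enc (σ p) then (0, Finsupp.single (eT ⟨p, h⟩) 1)
    else if h : enc (σ p) < enc (σ (σ p)) then (0, - Finsupp.single (eT ⟨σ p, h⟩) 1) else 0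
  have gF : ∀ p : F, g p = (Finsupp.single (eF p) 1, 0) := fun p => dif_pos p.2
  have gT : ∀ p : T, g p = (0, Finsupp.single (eT p) 1) := fun p => by
    have h1 : ¬ σ p.1 = p.1 := fun h => by have := p.2; rw [h] at this; exact lt_irrefl _ this
    simp only [g, dif_neg h1, dif_pos p.2]; rfl
  have gT' : ∀ p : T, g (σ p) = (0, - Finsupp.single (eT p) 1) := fun p => by
    have h1 : ¬ σ p.1 = p.1 := fun h => by have := p.2; rw [h] at this; exact lt_irrefl _ this
    have h2 : ¬ σ (σ p.1) = σ p.1 := by rw [hσ p.1]; exact fun h => h1 h.symm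
    have h3 : ¬ enc (σ p.1) < enc (σ (σ p.1)) := by rw [hσ p.1]; exact not_lt.2 p.2.le
    have h4 : enc (σ (σ p.1)) < enc (σ (σ (σ p.1))) := by rw [hσ p.1]; exact p.2
    have h5 : (⟨σ (σ p.1), h4⟩ : T) = p := Subtype.ext (hσ p.1)
    simp only [g, dif_neg h2, dif_neg h3, dif_pos h4, h5]
  have trichotomy : ∀ p : P, (∃ f : F, p = f) ∨ (∃ t : T, p = t) ∨ ∃ t : T, p = σ t := fun p => by
    rcases lt_trichotomy (enc p) (enc (σ p)) with h | h | h
    · exact Or.inr (Or.inl ⟨⟨p, h⟩, rfl⟩)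
    · exact Or.inl ⟨⟨p, (henc h).symm⟩, rfl⟩
    · exact Or.inr (Or.inr ⟨⟨σ p, by simpa [hσ p] using h⟩, (hσ p).symm⟩)
  let θ : (P →₀ ℤ) →+ (ℕ →₀ ZMod 2) × (ℕ →₀ ℤ) :=
    Finsupp.liftAddHom fun p => zmultiplesHom _ (g p)
  have hθ : ∀ p, θ (Finsupp.single p 1) = g p := fun p => by simp [θ]
  let mk := QuotientAddGroup.mk' S
  have mkσ : ∀ p, mk (Finsupp.single p 1) + mk (Finsupp.single (σ p) 1) = 0 := fun p => by
    rw [← map_add]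
    exact (QuotientAddGroup.eq_zero_iff _).2 ((hS _).2 ⟨Finsupp.single p 1, by simp⟩)
  have two : ∀ f : F, zmultiplesHom _ (mk (Finsupp.single f.1 1)) ((2 : ℕ) : ℤ) = 0 := fun f => by
    have := mkσ f.1
    rw [f.2] at this
    rw [zmultiplesHom_apply, Nat.cast_ofNat, two_zsmul]
    exact this
  let α : (ℕ →₀ ZMod 2) × (ℕ →₀ ℤ) →+ (P →₀ ℤ) ⧸ S :=
    (Finsupp.liftAddHom fun n => ZMod.lift 2 ⟨_, two (eF.symm n)⟩).coprod
      (Finsupp.liftAddHom fun n => zmultiplesHom _ (mk (Finsupp.single (eT.symm n).1 1)))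
  have hα : α.comp θ = mk := by
    ext p
    simp only [AddMonoidHom.comp_apply, Finsupp.singleAddHom_apply, hθ]
    rcases trichotomy p with ⟨f, rfl⟩ | ⟨t, rfl⟩ | ⟨t, rfl⟩
    · have h1 : ZMod.lift 2 ⟨_, two f⟩ (1 : ZMod 2) = mk (Finsupp.single f.1 1) := by
        have := ZMod.lift_coe 2 ⟨_, two f⟩ 1
        simpa using this
      simp [gF, α, h1]
    · simp [gT, α]
    · simp only [gT', α, AddMonoidHom.coprod_apply, map_zero, map_neg, zero_add]
      rw [neg_eq_iff_add_eq_zero]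
      simpa using mkσ t.1
  refine ⟨θ, ?_, fun x => ⟨fun hx => ?_, ?_⟩⟩
  · rw [← AddMonoidHom.range_eq_top, eq_top_iff]
    rintro ⟨a, b⟩ -
    have ha : ∀ a : ℕ →₀ ZMod 2, (a, (0 : ℕ →₀ ℤ)) ∈ θ.range := fun a => by
      induction a using Finsupp.induction_linear with
      | zero => exact zero_mem _
      | add x y hx hy => simpa using add_mem hx hy
      | single n c =>
        obtain ⟨c, rfl⟩ := ZMod.intCast_surjective c
        refine ⟨c • Finsupp.single (eF.symm n).1 1, ?_⟩
        rw [map_zsmul, hθ, gF]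
        simp
    have hb : ∀ b : ℕ →₀ ℤ, ((0 : ℕ →₀ ZMod 2), b) ∈ θ.range := fun b => by
      induction b using Finsupp.induction_linear with
      | zero => exact zero_mem _
      | add x y hx hy => simpa using add_mem hx hy
      | single n c =>
        refine ⟨c • Finsupp.single (eT.symm n).1 1, ?_⟩
        rw [map_zsmul, hθ, gT]
        simp
    simpa using add_mem (ha a) (hb b)
  · rw [← hS, ← QuotientAddGroup.eq_zero_iff]
    change mk x = 0
    rw [← hα, AddMonoidHom.comp_apply, hx, map_zero]
  · rintro ⟨k, rfl⟩
    rw [map_add]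
    induction k using Finsupp.induction_linear with
    | zero => simp
    | add x y hx hy =>
      rw [Finsupp.mapDomain_add, map_add, map_add, add_add_add_comm, hx, hy, add_zero]
    | single p c =>
      have hc : Finsupp.single p c = c • Finsupp.single p (1 : ℤ) := by simp
      have hc' : Finsupp.single (σ p) c = c • Finsupp.single (σ p) (1 : ℤ) := by simp
      rw [Finsupp.mapDomain_single, hc, hc', map_zsmul, map_zsmul, ← smul_add, hθ, hθ]
      suffices g p + g (σ p) = 0 by rw [this, smul_zero]
      rcases trichotomy p with ⟨f, rfl⟩ | ⟨t, rfl⟩ | ⟨t, rfl⟩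
      · rw [f.2, gF]
        simp only [Prod.mk_add_mk, ← Finsupp.single_add, add_zero]
        simp [show (1 + 1 : ZMod 2) = 0 from rfl]
      · simp [gT, gT']
      · simp [gT, gT', hσ t.1]

end Involution

section Factorization

variable (R : Type*) [CommRing R]

/-- The prime elements of `R` up to units. -/
abbrev PrimeClass : Type _ := {a : Associates R // Prime a}

variable {R}

/-- The class of a prime element. -/
def primeClass (r : R) (hr : Prime r) : PrimeClass R := ⟨Associates.mk r, Associates.prime_mk.2 hr⟩

theorem primeClass_eq_iff {r s : R} (hr : Prime r) (hs : Prime s) :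
    primeClass r hr = primeClass s hs ↔ Associated r s := by
  rw [primeClass, primeClass, Subtype.mk.injEq, Associates.mk_eq_mk_iff_associated]

theorem exists_eq_primeClass (a : PrimeClass R) : ∃ r hr, a = primeClass (R := R) r hr := by
  obtain ⟨a, ha⟩ := a
  obtain ⟨r, rfl⟩ := Associates.mk_surjective a
  exact ⟨r, Associates.prime_mk.1 ha, rfl⟩

theorem nonpos_of_prod_zpow_eq_unit [IsDomain R] {K P : Type*} [Field K] [Algebra R K]
    [IsFractionRing R K] (rep : P → R) (hrep : ∀ p, Prime (rep p))
    (hassoc : ∀ p q, Associated (rep p) (rep q) → p = q)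
    (n : P →₀ ℤ) (u : Rˣ) (h : n.prod (fun p k => algebraMap R K (rep p) ^ k) = algebraMap R K u)
    (p : P) : n p ≤ 0 := by
  by_contra! hp
  have h0 : ∀ q, algebraMap R K (rep q) ≠ 0 := fun q =>
    (map_ne_zero_iff _ (IsFractionRing.injective R K)).2 (hrep q).ne_zero
  have hAB : ∏ q ∈ n.support, rep q ^ (n q).toNat = u * ∏ q ∈ n.support, rep q ^ (-n q).toNat := by
    apply IsFractionRing.injective R K
    rw [map_mul, ← h, map_prod, map_prod, Finsupp.prod, ← Finset.prod_mul_distrib]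
    refine Finset.prod_congr rfl fun q _ => ?_
    rw [map_pow, map_pow, ← zpow_natCast, ← zpow_natCast, ← zpow_add₀ (h0 q)]
    congr 1
    lia
  have hdvd : rep p ∣ ∏ q ∈ n.support, rep q ^ (n q).toNat :=
    (dvd_pow_self _ (by lia)).trans
      (Finset.dvd_prod_of_mem _ (Finsupp.mem_support_iff.2 hp.ne'))
  rw [hAB, Units.dvd_mul_left] at hdvd
  obtain ⟨q, -, hq⟩ := (hrep p).exists_mem_finset_dvd hdvd
  have hpq := hassoc _ _ ((hrep p).associated_of_dvd (hrep q) ((hrep p).dvd_of_dvd_pow hq))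
  subst hpq
  rw [show (-n p).toNat = 0 by lia, pow_zero] at hq
  exact (hrep p).not_isUnit (isUnit_of_dvd_one hq)

variable [IsDomain R] (K : Type*) [Field K] [Algebra R K] [IsFractionRing R K]

/-- The unit of the fraction field given by a nonzero element. -/
def fracUnit (r : R) (hr : r ≠ 0) : Kˣ :=
  Units.mk0 (algebraMap R K r) ((map_ne_zero_iff _ (IsFractionRing.injective R K)).2 hr)

variable {K}

theorem fracUnit_mul {r s : R} (hr : r ≠ 0) (hs : s ≠ 0) :
    fracUnit K (r * s) (mul_ne_zero hr hs) = fracUnit K r hr * fracUnit K s hs := by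
  ext
  simp [fracUnit]

theorem subgroup_eq_top_of_primes [UniqueFactorizationMonoid R] {S : Subgroup Kˣ}
    (hunit : ∀ u : Rˣ, fracUnit K (u : R) u.ne_zero ∈ S)
    (hprime : ∀ (r : R) (hr : Prime r), fracUnit K r hr.ne_zero ∈ S) : S = ⊤ := by
  have key : ∀ (r : R) (hr : r ≠ 0), fracUnit K r hr ∈ S := by
    intro r
    induction r using UniqueFactorizationMonoid.induction_on_prime with
    | h₁ => exact fun h => absurd rfl h
    | h₂ x hx => exact fun _ => hunit hx.unit
    | h₃ a p ha hp ih =>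
      intro _
      rw [fracUnit_mul hp.ne_zero ha]
      exact mul_mem (hprime p hp) (ih ha)
  rw [eq_top_iff]
  rintro x -
  obtain ⟨a, b, hb, hx⟩ := IsFractionRing.div_surjective (A := R) (x : K)
  have hb0 : b ≠ 0 := nonZeroDivisors.ne_zero hb
  have ha0 : a ≠ 0 := by
    rintro rfl
    rw [map_zero, zero_div] at hx
    exact x.ne_zero hx.symm
  have : x = fracUnit K a ha0 / fracUnit K b hb0 := by
    ext
    simp [fracUnit, hx]
  rw [this]
  exact div_mem (key a ha0) (key b hb0)

/-- The exponents of primes in the factorization of elements of the fraction field. -/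
theorem exists_factorization_hom (R K : Type*) [CommRing R] [IsDomain R]
    [UniqueFactorizationMonoid R] [Field K] [Algebra R K] [IsFractionRing R K] :
    ∃ D : Kˣ →* Multiplicative (PrimeClass R →₀ ℤ), Function.Surjective D ∧
      (∀ x, D x = 1 ↔ ∃ u : Rˣ, x = fracUnit K (u : R) u.ne_zero) ∧
      ∀ (r : R) (hr : Prime r),
        D (fracUnit K r hr.ne_zero) = Multiplicative.ofAdd (Finsupp.single (primeClass r hr) 1) := by
  choose rep hrep hrep' using exists_eq_primeClass (R := R)
  let U : Subgroup Kˣ := (Units.map (algebraMap R K : R →* K)).range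
  have hU : ∀ x, x ∈ U ↔ ∃ u : Rˣ, x = fracUnit K (u : R) u.ne_zero := fun x =>
    exists_congr fun u => by
      rw [eq_comm, Units.ext_iff, Units.ext_iff]
      rfl
  let g : PrimeClass R → Kˣ := fun p => fracUnit K (rep p) (hrep p).ne_zero
  let L : Multiplicative (PrimeClass R →₀ ℤ) →* Kˣ :=
    AddMonoidHom.toMultiplicativeLeft (Finsupp.liftAddHom fun p =>
      zmultiplesHom _ (Additive.ofMul (g p)))
  have hL : ∀ n : PrimeClass R →₀ ℤ,
      (L (Multiplicative.ofAdd n) : K) = n.prod fun p k => algebraMap R K (rep p) ^ k := by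
    intro n
    induction n using Finsupp.induction_linear with
    | zero => simp
    | add x y hx hy =>
      rw [ofAdd_add, map_mul, Units.val_mul, hx, hy, Finsupp.prod_add_index']
      · simp
      · exact fun p a b => zpow_add₀ (g p).ne_zero a b
    | single p k =>
      rw [Finsupp.prod_single_index (by simp)]
      simp [L, g, fracUnit]
  let Λ := (QuotientGroup.mk' U).comp L
  have hassoc : ∀ p q, Associated (rep p) (rep q) → p = q := fun p q h => by
    rw [hrep' p, hrep' q, primeClass_eq_iff]
    exact h
  have le : ∀ n : PrimeClass R →₀ ℤ, Λ (Multiplicative.ofAdd n) = 1 → ∀ p, n p ≤ 0 := by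
    intro n hn
    obtain ⟨u, hu⟩ := (hU _).1 ((QuotientGroup.eq_one_iff _).1 hn)
    refine nonpos_of_prod_zpow_eq_unit (K := K) rep hrep hassoc n u ?_
    rw [← hL, hu]
    rfl
  have inj : Function.Injective Λ := by
    rw [injective_iff_map_eq_one]
    intro n hn
    have h1 := le n.toAdd hn
    have h2 := le (-n.toAdd) (by rw [ofAdd_neg, map_inv]; exact inv_eq_one.2 hn)
    apply Multiplicative.toAdd.injective
    ext p
    exact le_antisymm (h1 p) (by simpa using h2 p)
  have hΛ : ∀ (r : R) (hr : Prime r),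
      Λ (Multiplicative.ofAdd (Finsupp.single (primeClass r hr) 1)) =
        QuotientGroup.mk' U (fracUnit K r hr.ne_zero) := by
    intro r hr
    obtain ⟨u, hu⟩ := (primeClass_eq_iff (hrep _) hr).1 (hrep' (primeClass r hr)).symm
    refine (QuotientGroup.eq).2 ((hU _).2 ⟨u, ?_⟩)
    rw [inv_mul_eq_iff_eq_mul]
    ext
    rw [Units.val_mul, hL, Finsupp.prod_single_index (by simp)]
    rw [zpow_one]
    change algebraMap R K r = _
    exact (congrArg (algebraMap R K) hu.symm).trans (map_mul _ _ _)
  have surj : Function.Surjective Λ := by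
    have : Λ.range.comap (QuotientGroup.mk' U) = ⊤ := by
      refine subgroup_eq_top_of_primes (R := R) (fun u => ?_) fun r hr => ⟨_, hΛ r hr⟩
      refine ⟨1, ?_⟩
      rw [map_one]
      exact ((QuotientGroup.eq_one_iff _).2 ((hU _).2 ⟨u, rfl⟩)).symm
    intro y
    obtain ⟨x, rfl⟩ := QuotientGroup.mk'_surjective U y
    have hx : x ∈ Λ.range.comap (QuotientGroup.mk' U) := this ▸ Subgroup.mem_top x
    exact hx
  let e := MulEquiv.ofBijective Λ ⟨inj, surj⟩
  refine ⟨(e.symm : _ →* _).comp (QuotientGroup.mk' U), ?_, fun x => ?_, fun r hr => ?_⟩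
  · exact e.symm.surjective.comp (QuotientGroup.mk'_surjective U)
  · rw [← hU, ← QuotientGroup.eq_one_iff]
    exact map_eq_one_iff _ e.symm.injective
  · exact e.symm_apply_eq.2 (hΛ r hr).symm

end Factorization

section GroupRing

variable {m : ℕ}

theorem isUnit_single (h : Fin m → ℤ) (u : ℤˣ) :
    IsUnit (AddMonoidAlgebra.single h (u : ℤ) : GR m) :=
  IsUnit.of_mul_eq_one (AddMonoidAlgebra.single (-h) ((u⁻¹ : ℤˣ) : ℤ)) <| by
    rw [AddMonoidAlgebra.single_mul_single, add_neg_cancel, Units.mul_inv]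
    rfl

theorem exists_eq_single_of_isUnit {f : GR m} (hf : IsUnit f) :
    ∃ (u : ℤˣ) (h : Fin m → ℤ), f = AddMonoidAlgebra.single h (u : ℤ) := by
  obtain ⟨g, hfg⟩ := hf.exists_right_inv
  have hf0 : f.coeff.support.Nonempty := by
    rw [Finsupp.support_nonempty_iff, ne_eq, AddMonoidAlgebra.coeff_eq_zero]
    exact hf.ne_zero
  have hg0 : g.coeff.support.Nonempty := by
    rw [Finsupp.support_nonempty_iff, ne_eq, AddMonoidAlgebra.coeff_eq_zero]
    rintro rfl
    simp at hfg
  have key : ∀ a ∈ f.coeff.support, ∀ b ∈ g.coeff.support,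
      UniqueAdd f.coeff.support g.coeff.support a b → a + b = 0 := by
    intro a ha b hb h
    have := AddMonoidAlgebra.coeff_mul_add_of_uniqueAdd h
    rw [hfg, AddMonoidAlgebra.one_def, AddMonoidAlgebra.coeff_single] at this
    by_contra hab
    rw [Finsupp.single_eq_of_ne hab] at this
    exact mul_ne_zero (Finsupp.mem_support_iff.1 ha) (Finsupp.mem_support_iff.1 hb) this.symm
  have hcard : f.coeff.support.card * g.coeff.support.card ≤ 1 := by
    by_contra! hlt
    obtain ⟨x, hx, y, hy, hne, h1, h2⟩ := TwoUniqueSums.uniqueAdd_of_one_lt_card hlt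
    rw [Finset.mem_product] at hx hy
    have := h1 hy.1 hy.2 ((key _ hy.1 _ hy.2 h2).trans (key _ hx.1 _ hx.2 h1).symm)
    exact hne (Prod.ext this.1.symm this.2.symm)
  have hf1 : f.coeff.support.card = 1 := by
    have := hf0.card_pos
    have := hg0.card_pos
    nlinarith
  have hg1 : g.coeff.support.card = 1 := by
    have := hf0.card_pos
    have := hg0.card_pos
    nlinarith
  obtain ⟨h, a, -, hf2⟩ := Finsupp.card_support_eq_one'.1 hf1
  obtain ⟨k, b, -, hg2⟩ := Finsupp.card_support_eq_one'.1 hg1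
  have hf3 : f = AddMonoidAlgebra.single h a := AddMonoidAlgebra.coeff_injective hf2
  have hg3 : g = AddMonoidAlgebra.single k b := AddMonoidAlgebra.coeff_injective hg2
  rw [hf3, hg3, AddMonoidAlgebra.single_mul_single, AddMonoidAlgebra.one_def] at hfg
  have hab : a * b = 1 := by
    have hs : Finsupp.single (h + k) (a * b) = Finsupp.single 0 1 :=
      congrArg AddMonoidAlgebra.coeff hfg
    rcases Finsupp.single_eq_single_iff .. |>.1 hs with h1 | h1
    · exact h1.2
    · exact absurd h1.2 one_ne_zero
  obtain ⟨u, rfl⟩ := IsUnit.of_mul_eq_one b hab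
  exact ⟨u, h, hf3⟩

/-- The inclusion of the exponents of polynomials into the exponents of Laurent polynomials. -/
def expHom (m : ℕ) : (Fin m →₀ ℕ) →+ (Fin m → ℤ) where
  toFun s i := s i
  map_zero' := by ext; simp
  map_add' _ _ := by ext; simp

theorem expHom_injective (m : ℕ) : Function.Injective (expHom m) := fun s t h => by
  ext i
  exact Int.ofNat_inj.1 (congrFun h i)

/-- The inclusion of polynomials into Laurent polynomials. -/
def polyHom (m : ℕ) : MvPolynomial (Fin m) ℤ →+* GR m :=
  AddMonoidAlgebra.mapDomainRingHom ℤ (expHom m)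

theorem polyHom_monomial (s : Fin m →₀ ℕ) (c : ℤ) :
    polyHom m (MvPolynomial.monomial s c) = AddMonoidAlgebra.single (expHom m s) c :=
  AddMonoidAlgebra.mapDomain_single

theorem polyHom_injective (m : ℕ) : Function.Injective (polyHom m) :=
  AddMonoidAlgebra.mapDomain_injective (expHom_injective m)

theorem exists_mul_single_eq_polyHom (f : GR m) :
    ∃ (s : Fin m →₀ ℕ) (g : MvPolynomial (Fin m) ℤ),
      f * AddMonoidAlgebra.single (expHom m s) 1 = polyHom m g := by
  induction f using AddMonoidAlgebra.induction_linear with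
  | zero => exact ⟨0, 0, by simp⟩
  | add f g hf hg =>
    obtain ⟨s, a, ha⟩ := hf
    obtain ⟨t, b, hb⟩ := hg
    refine ⟨s + t, a * MvPolynomial.monomial t 1 + b * MvPolynomial.monomial s 1, ?_⟩
    have hst : (AddMonoidAlgebra.single (expHom m (s + t)) 1 : GR m) =
        AddMonoidAlgebra.single (expHom m s) 1 * AddMonoidAlgebra.single (expHom m t) 1 := by
      rw [AddMonoidAlgebra.single_mul_single, map_add, one_mul]
    rw [map_add (polyHom m), map_mul, map_mul, ← ha, ← hb, polyHom_monomial, polyHom_monomial, hst]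
    ring
  | single h c =>
    refine ⟨Finsupp.equivFunOnFinite.symm fun i => (-h i).toNat,
      MvPolynomial.monomial (Finsupp.equivFunOnFinite.symm fun i => (h i).toNat) c, ?_⟩
    rw [polyHom_monomial, AddMonoidAlgebra.single_mul_single, mul_one]
    congr 1
    ext i
    simp only [expHom, AddMonoidHom.coe_mk, ZeroHom.coe_mk, Pi.add_apply,
      Finsupp.equivFunOnFinite_symm_apply_apply]
    lia

instance uniqueFactorizationMonoid_GR (m : ℕ) : UniqueFactorizationMonoid (GR m) := by
  let _ : Algebra (MvPolynomial (Fin m) ℤ) (GR m) := (polyHom m).toAlgebra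
  let S : Submonoid (MvPolynomial (Fin m) ℤ) :=
    MonoidHom.mrange (MvPolynomial.monomialOneHom ℤ (Fin m))
  have : IsLocalization S (GR m) := by
    rw [isLocalization_iff]
    refine ⟨?_, fun z => ?_, fun {x y} hxy => ⟨1, by rw [polyHom_injective m hxy]⟩⟩
    · rintro ⟨-, s, rfl⟩
      change IsUnit (polyHom m (MvPolynomial.monomial s.toAdd 1))
      rw [polyHom_monomial]
      exact isUnit_single _ 1
    · obtain ⟨s, g, h⟩ := exists_mul_single_eq_polyHom z
      refine ⟨(g, ⟨_, Multiplicative.ofAdd s, rfl⟩), ?_⟩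
      change z * polyHom m (MvPolynomial.monomial s 1) = polyHom m g
      rw [polyHom_monomial, h]
  exact UniqueFactorizationMonoid.of_isLocalization S (GR m)

theorem coeff_natCast_mul (n : ℕ) (f : GR m) (h : Fin m → ℤ) :
    ((n : GR m) * f).coeff h = n * f.coeff h := by
  rw [← nsmul_eq_mul, AddMonoidAlgebra.coeff_smul_apply, nsmul_eq_mul]

theorem prime_natCast {p : ℕ} (hp : p.Prime) : Prime (p : GR m) := by
  have := Fact.mk hp
  let ψ : GR m →+* AddMonoidAlgebra (ZMod p) (Fin m → ℤ) :=
    AddMonoidAlgebra.mapRingHom _ (Int.castRingHom (ZMod p))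
  have hψ : ∀ f : GR m, (p : GR m) ∣ f ↔ ψ f = 0 := by
    refine fun f => ⟨?_, fun h => ?_⟩
    · rintro ⟨g, rfl⟩
      have : (p : AddMonoidAlgebra (ZMod p) (Fin m → ℤ)) = 0 := by
        rw [← map_natCast (algebraMap (ZMod p) _), ZMod.natCast_self, map_zero]
      rw [map_mul, map_natCast, this, zero_mul]
    · have hc : ∀ h, (p : ℤ) ∣ f.coeff h := fun k => by
        rw [← ZMod.intCast_zmod_eq_zero_iff_dvd]
        have := congrArg (fun r => AddMonoidAlgebra.coeff r k) h
        simpa [ψ] using this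
      refine ⟨AddMonoidAlgebra.ofCoeff (f.coeff.mapRange (· / (p : ℤ)) (by simp)), ?_⟩
      ext k
      rw [coeff_natCast_mul]
      exact (Int.mul_ediv_cancel' (hc k)).symm
  refine ⟨?_, fun hu => ?_, fun a b hab => ?_⟩
  · intro h0
    have := (coeff_natCast_mul p (1 : GR m) 0).symm
    simp [h0, hp.ne_zero] at this
  · have := (hψ 1).1 hu.dvd
    rw [map_one] at this
    exact one_ne_zero this
  · rw [hψ, map_mul, mul_eq_zero] at hab
    rwa [hψ, hψ]

end GroupRing

section Bar

variable {m : ℕ}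

theorem barR_single (h : Fin m → ℤ) (c : ℤ) :
    barR m (AddMonoidAlgebra.single h c) = AddMonoidAlgebra.single (-h) c :=
  AddMonoidAlgebra.domCongr_single (R := ℤ) (A := ℤ) (AddEquiv.neg (Fin m → ℤ)) h c

theorem barR_barR (f : GR m) : barR m (barR m f) = f := by
  induction f using AddMonoidAlgebra.induction_linear with
  | zero => simp
  | add f g hf hg => rw [map_add, map_add, hf, hg]
  | single h c => rw [barR_single, barR_single, neg_neg]

theorem prime_barR {r : GR m} (hr : Prime r) : Prime (barR m r) :=
  (MulEquiv.prime_iff (barR m).toMulEquiv).2 hr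

/-- The involution on units of the fraction field. -/
def barUnits (m : ℕ) : (QF m)ˣ →* (QF m)ˣ := Units.map (barQ m : QF m →* QF m)

theorem barUnits_fracUnit (r : GR m) (hr : r ≠ 0) (hr' : barR m r ≠ 0) :
    barUnits m (fracUnit (QF m) r hr) = fracUnit (QF m) (barR m r) hr' := by
  ext
  exact IsFractionRing.ringEquivOfRingEquiv_algebraMap (barR m) r

/-- The involution on classes of primes. -/
def barPrime (a : PrimeClass (GR m)) : PrimeClass (GR m) :=
  primeClass (barR m (exists_eq_primeClass a).choose)
    (prime_barR (exists_eq_primeClass a).choose_spec.choose)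

theorem barPrime_primeClass (r : GR m) (hr : Prime r) :
    barPrime (primeClass r hr) = primeClass (barR m r) (prime_barR hr) := by
  obtain ⟨hs, h⟩ := (exists_eq_primeClass (primeClass r hr)).choose_spec
  rw [primeClass_eq_iff] at h
  exact (primeClass_eq_iff _ _).2 (h.symm.map (barR m))

theorem barPrime_involutive : Function.Involutive (barPrime (m := m)) := fun a => by
  obtain ⟨r, hr, rfl⟩ := exists_eq_primeClass a
  simp only [barPrime_primeClass, barR_barR]

instance : Countable (PrimeClass (GR m)) := by
  have : Countable (GR m) := AddMonoidAlgebra.coeff_injective.countable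
  have : Countable (Associates (GR m)) := Associates.mk_surjective.countable
  infer_instance

theorem infinite_setOf_barPrime_eq : {a : PrimeClass (GR m) | barPrime a = a}.Infinite := by
  refine Set.infinite_of_injective_forall_mem (α := Nat.Primes)
    (f := fun p => primeClass (p : GR m) (prime_natCast p.2)) (fun p q h => ?_) fun p => ?_
  · obtain ⟨g, hg⟩ := ((primeClass_eq_iff _ _).1 h).dvd
    have h0 := coeff_natCast_mul p g 0
    rw [← hg, ← mul_one (q : GR m), coeff_natCast_mul, AddMonoidAlgebra.one_def,
      AddMonoidAlgebra.coeff_single, Finsupp.single_eq_same, mul_one] at h0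
    exact Subtype.ext ((Nat.prime_dvd_prime_iff_eq p.2 q.2).1
      (Int.natCast_dvd_natCast.1 ⟨_, h0⟩))
  · simp [barPrime_primeClass]

/-- Evaluation of the `i`-th variable at `t` and of the other variables at `1`. -/
def evalVar (i : Fin m) (t : ℚˣ) : GR m →+* ℚ :=
  (AddMonoidAlgebra.lift ℤ ℚ (Fin m → ℤ)
    { toFun := fun h => ((t ^ h.toAdd i : ℚˣ) : ℚ)
      map_one' := by simp
      map_mul' := fun a b => by simp [zpow_add] } : GR m →ₐ[ℤ] ℚ)

theorem evalVar_single (i : Fin m) (t : ℚˣ) (h : Fin m → ℤ) (c : ℤ) :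
    evalVar i t (AddMonoidAlgebra.single h c) = c * ((t ^ h i : ℚˣ) : ℚ) := by
  simp [evalVar, AddMonoidAlgebra.lift_single]

theorem exists_prime_dvd_map_eq_zero {R A : Type*} [CommRing R] [IsDomain R]
    [UniqueFactorizationMonoid R] [CommRing A] [IsDomain A] (φ : R →+* A) {f : R} (hf : f ≠ 0)
    (h : φ f = 0) : ∃ r, Prime r ∧ r ∣ f ∧ φ r = 0 := by
  have h1 : φ (UniqueFactorizationMonoid.factors f).prod = 0 := by
    have := map_dvd φ (UniqueFactorizationMonoid.factors_prod hf).dvd'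
    rwa [h, zero_dvd_iff] at this
  rw [map_multiset_prod, Multiset.prod_eq_zero_iff, Multiset.mem_map] at h1
  obtain ⟨r, hr, hr0⟩ := h1
  exact ⟨r, UniqueFactorizationMonoid.prime_of_factor r hr,
    UniqueFactorizationMonoid.dvd_of_mem_factors hr, hr0⟩

theorem map_eq_zero_of_dvd {R A : Type*} [CommRing R] [CommRing A] (φ : R →+* A) {r s : R}
    (h : r ∣ s) (hr : φ r = 0) : φ s = 0 := by
  have := map_dvd φ h
  rwa [hr, zero_dvd_iff] at this

theorem infinite_setOf_barPrime_ne (i : Fin m) :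
    {a : PrimeClass (GR m) | barPrime a ≠ a}.Infinite := by
  let t : ℕ → ℚˣ := fun n => Units.mk0 (n + 2 : ℚ) (by positivity)
  let f : ℕ → GR m := fun n =>
    AddMonoidAlgebra.single (Pi.single i 1) 1 - AddMonoidAlgebra.single 0 (n + 2 : ℤ)
  have hf : ∀ a b, evalVar i (t b) (f a) = b - a := fun a b => by
    simp [f, t, evalVar_single]
  have hf' : ∀ a b, evalVar i (t b) (barR m (f a)) = (b + 2 : ℚ)⁻¹ - (a + 2) := fun a b => by
    simp [f, t, barR_single, evalVar_single]
  have hf0 : ∀ n, f n ≠ 0 := fun n h => by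
    have := hf n (n + 1)
    simp [h] at this
  choose r hr hrf hr0 using fun n =>
    exists_prime_dvd_map_eq_zero (evalVar i (t n)) (hf0 n) (by simp [hf])
  refine Set.infinite_of_injective_forall_mem (f := fun n => primeClass (r n) (hr n))
    (fun a b h => ?_) fun n h => ?_
  · have h1 := map_eq_zero_of_dvd _ (((primeClass_eq_iff _ _).1 h).dvd'.trans (hrf a)) (hr0 b)
    rw [hf, sub_eq_zero] at h1
    exact_mod_cast h1.symm
  · rw [barPrime_primeClass, primeClass_eq_iff] at h
    have h1 := map_eq_zero_of_dvd _ (h.dvd'.trans (map_dvd (barR m) (hrf n))) (hr0 n)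
    rw [hf', sub_eq_zero] at h1
    have hn : (0 : ℚ) ≤ n := by positivity
    have := inv_lt_one_of_one_lt₀ (show (1 : ℚ) < n + 2 by linarith)
    linarith

end Bar

/-- **Theorem 8.2, case of rank at least two.**
If `H` is a finitely generated free abelian group of rank `m ≥ 2`, then
`Q(H)^×/N(H)` is isomorphic to `(⊕_{i∈ℕ} ℤ/2) ⊕ (⊕_{i∈ℕ} ℤ)`. -/
theorem quotient_by_norms_iso (m : ℕ) (hm : 2 ≤ m) :
    Nonempty (((QF m)ˣ ⧸ NH m) ≃*
      Multiplicative ((ℕ →₀ ZMod 2) × (ℕ →₀ ℤ))) := by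
  obtain ⟨D, hDsurj, hDker, hDprime⟩ := exists_factorization_hom (GR m) (QF m)
  obtain ⟨θ, hθsurj, hθker⟩ := exists_hom_ker_eq_range_add_mapDomain
    (barPrime_involutive (m := m)) infinite_setOf_barPrime_eq
    (infinite_setOf_barPrime_ne ⟨0, by lia⟩)
  have hDbar : ∀ x, D (barUnits m x) =
      Multiplicative.ofAdd (Finsupp.mapDomain barPrime (D x).toAdd) := by
    have htop : MonoidHom.eqLocus (D.comp (barUnits m))
        ((AddMonoidHom.toMultiplicative (Finsupp.mapDomain.addMonoidHom barPrime)).comp D) = ⊤ := by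
      refine subgroup_eq_top_of_primes (R := GR m) (fun u => ?_) fun r hr => ?_
      · change D (barUnits m _) = Multiplicative.ofAdd (Finsupp.mapDomain barPrime (D _).toAdd)
        rw [(hDker _).2 ⟨u, rfl⟩, toAdd_one, Finsupp.mapDomain_zero, ofAdd_zero, hDker]
        exact ⟨Units.map (barR m : GR m →* GR m) u, barUnits_fracUnit _ _ _⟩
      · change D (barUnits m _) = Multiplicative.ofAdd (Finsupp.mapDomain barPrime (D _).toAdd)
        rw [barUnits_fracUnit _ _ (prime_barR hr).ne_zero, hDprime r hr, hDprime _ (prime_barR hr),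
          toAdd_ofAdd, Finsupp.mapDomain_single, barPrime_primeClass]
    intro x
    have hx : x ∈ MonoidHom.eqLocus (D.comp (barUnits m))
        ((AddMonoidHom.toMultiplicative (Finsupp.mapDomain.addMonoidHom barPrime)).comp D) :=
      htop ▸ Subgroup.mem_top x
    exact hx
  let Φ : (QF m)ˣ →* Multiplicative ((ℕ →₀ ZMod 2) × (ℕ →₀ ℤ)) :=
    (AddMonoidHom.toMultiplicative θ).comp D
  have hΦsurj : Function.Surjective Φ := hθsurj.comp hDsurj
  have hΦker : ∀ x, Φ x = 1 ↔
      ∃ k, (D x).toAdd = k + Finsupp.mapDomain barPrime k := fun x => hθker (D x).toAdd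
  have hker : NH m = Φ.ker := by
    apply le_antisymm
    · rw [NH, Subgroup.closure_le]
      rintro x ⟨u, h, q, hx⟩
      obtain ⟨v, hv⟩ := isUnit_single h u
      have hx' : x = fracUnit (QF m) (v : GR m) v.ne_zero * q * barUnits m q := by
        ext
        rw [hx, ← hv]
        rfl
      refine (hΦker x).2 ⟨(D q).toAdd, ?_⟩
      rw [hx', map_mul D, map_mul D, hDbar, (hDker _).2 ⟨v, rfl⟩, one_mul]
      rfl
    · intro x hx
      obtain ⟨k, hk⟩ := (hΦker x).1 hx
      obtain ⟨q, hq⟩ := hDsurj (Multiplicative.ofAdd k)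
      obtain ⟨v, hv⟩ := (hDker (x / (q * barUnits m q))).1 <| by
        rw [map_div, map_mul, hDbar, hq, div_eq_one]
        exact hk
      obtain ⟨u, h, huv⟩ := exists_eq_single_of_isUnit v.isUnit
      refine Subgroup.subset_closure ⟨u, h, q, ?_⟩
      rw [div_eq_iff_eq_mul, ← mul_assoc] at hv
      rw [hv, ← huv]
      rfl
  exact ⟨(QuotientGroup.quotientMulEquivOfEq hker).trans
    (QuotientGroup.quotientKerEquivOfSurjective Φ hΦsurj)⟩
end
end
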